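/- arXiv:math/9912107 — 2 statements merged into one kernel-verified Lean document; each statement's English description precedes it below -/
import Mathlib

section
/- For every prime p, every positive integer ℓ, and every positive integer k, the rational number ⌊k²/p^ℓ⌋ + (2k − p^ℓ)·⌊(k−1)/p^ℓ⌋ + (p^ℓ/2 − 2k)·⌊(2k−1)/p^ℓ⌋ − p^ℓ·⌊(k−1)/p^ℓ⌋² + (p^ℓ/2)·⌊(2k−1)/p^ℓ⌋² is a nonnegative integer. -/
open Finset

/-- The floor of `x / q` is the integer `c` with `c * q ≤ x < (c + 1) * q`. -/
theorem floor_div_eq_of_mul_le_of_lt_mul {x q : ℚ} {c : ℤ} (hq : 0 < q)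
    (h₁ : c * q ≤ x) (h₂ : x < (c + 1) * q) : ⌊x / q⌋ = c :=
  Int.floor_eq_iff.2 ⟨(le_div_iff₀ hq).2 h₁, (div_lt_iff₀ hq).2 h₂⟩

/-- For every prime `p`, positive integer `ℓ`, and positive integer
`k`, the rational number
`⌊k²/p^ℓ⌋ + (2k − p^ℓ)⌊(k−1)/p^ℓ⌋ + (p^ℓ/2 − 2k)⌊(2k−1)/p^ℓ⌋ − p^ℓ⌊(k−1)/p^ℓ⌋² +
(p^ℓ/2)⌊(2k−1)/p^ℓ⌋²` is a nonnegative integer. -/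
theorem vp_gU_summand_nonneg (p : ℕ) (hp : p.Prime) (l : ℕ) (hl : 0 < l)
    (k : ℕ) (hk : 0 < k) :
    ∃ n : ℕ,
      ((⌊(k : ℚ) ^ 2 / (p : ℚ) ^ l⌋ : ℚ) +
        (2 * (k : ℚ) - (p : ℚ) ^ l) * (⌊((k : ℚ) - 1) / (p : ℚ) ^ l⌋ : ℚ) +
        ((p : ℚ) ^ l / 2 - 2 * (k : ℚ)) * (⌊(2 * (k : ℚ) - 1) / (p : ℚ) ^ l⌋ : ℚ) -
        (p : ℚ) ^ l * (⌊((k : ℚ) - 1) / (p : ℚ) ^ l⌋ : ℚ) ^ 2 +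
        (p : ℚ) ^ l / 2 * (⌊(2 * (k : ℚ) - 1) / (p : ℚ) ^ l⌋ : ℚ) ^ 2) = (n : ℚ) := by
  have hq : 0 < p ^ l := pow_pos hp.pos l
  rw [← Nat.cast_pow p l]
  generalize p ^ l = q at hq ⊢
  have hqQ : (0 : ℚ) < q := by exact_mod_cast hq
  obtain ⟨a, r, hr, rfl⟩ : ∃ a r : ℕ, r < q ∧ k = q * a + r + 1 :=
    ⟨(k - 1) / q, (k - 1) % q, Nat.mod_lt _ hq, by have := Nat.div_add_mod (k - 1) q; omega⟩
  obtain ⟨t, u, hu, ht⟩ : ∃ t u : ℕ, u < q ∧ (r + 1) ^ 2 = q * t + u :=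
    ⟨(r + 1) ^ 2 / q, (r + 1) ^ 2 % q, Nat.mod_lt _ hq, (Nat.div_add_mod _ _).symm⟩
  have hrQ : (r : ℚ) + 1 ≤ q := by exact_mod_cast hr
  have huQ : (u : ℚ) < q := by exact_mod_cast hu
  have htQ : ((r : ℚ) + 1) ^ 2 = q * t + u := by exact_mod_cast ht
  have hr0 : (0 : ℚ) ≤ r := r.cast_nonneg
  have hu0 : (0 : ℚ) ≤ u := u.cast_nonneg
  have floor_sq : ⌊((q * a + r + 1 : ℕ) : ℚ) ^ 2 / q⌋
      = (q * a ^ 2 + 2 * a * (r + 1) + t : ℤ) := by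
    apply floor_div_eq_of_mul_le_of_lt_mul hqQ <;> push_cast <;> linarith
  have floor_pred : ⌊(((q * a + r + 1 : ℕ) : ℚ) - 1) / q⌋ = (a : ℤ) := by
    apply floor_div_eq_of_mul_le_of_lt_mul hqQ <;> push_cast <;> linarith
  rw [floor_sq, floor_pred]
  rcases lt_or_ge (2 * r + 1) q with h | h
  · have hQ : 2 * (r : ℚ) + 1 < q := by exact_mod_cast h
    have floor_double : ⌊(2 * ((q * a + r + 1 : ℕ) : ℚ) - 1) / q⌋ = (2 * a : ℤ) := by
      apply floor_div_eq_of_mul_le_of_lt_mul hqQ <;> push_cast <;> linarith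
    rw [floor_double]
    exact ⟨t, by push_cast; ring⟩
  · have hQ : (q : ℚ) ≤ 2 * r + 1 := by exact_mod_cast h
    have floor_double : ⌊(2 * ((q * a + r + 1 : ℕ) : ℚ) - 1) / q⌋ = (2 * a + 1 : ℤ) := by
      apply floor_div_eq_of_mul_le_of_lt_mul hqQ <;> push_cast <;> linarith
    rw [floor_double]
    have hnonneg : 2 * (r + 1) ≤ t + q := by
      by_contra! hlt
      have hltQ : (t : ℚ) + q + 1 ≤ 2 * (r + 1) := by exact_mod_cast hlt
      nlinarith [sq_nonneg ((r : ℚ) + 1 - q), mul_le_mul_of_nonneg_left hltQ hqQ.le]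
    obtain ⟨n, hn⟩ := Nat.exists_eq_add_of_le hnonneg
    have hnQ : (t : ℚ) + q = 2 * (r + 1) + n := by exact_mod_cast hn
    exact ⟨n, by push_cast; linear_combination hnQ⟩
end

section
/- Let p ≥ 2 be an integer and let f : ℝ → ℝ be continuous with f(x+1) = f(x) for all x, and suppose there exist constants C > 0 and δ > 0 such that |f(x)| ≤ C x² whenever |x| ≤ δ. Then for every real x the family (p^{-ℓ} f(p^ℓ x))_{ℓ∈ℤ} is summable; moreover the function d(x) = Σ_{ℓ∈ℤ} p^{-ℓ} f(p^ℓ x) is continuous on ℝ and satisfies d(px) = p·d(x) for all real x. -/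
open Filter

/-- A periodic continuous function which is `O(x²)` near `0` is bounded and is globally
dominated by a multiple of `x²`. -/
theorem exists_bound_and_sq_bound_of_periodic {f : ℝ → ℝ} {c : ℝ} (hc : c ≠ 0)
    (hcont : Continuous f) (hper : Function.Periodic f c)
    (hbound : ∃ C > (0 : ℝ), ∃ δ > (0 : ℝ), ∀ x : ℝ, |x| ≤ δ → |f x| ≤ C * x ^ 2) :
    ∃ M ≥ (0 : ℝ), ∀ x, |f x| ≤ M ∧ |f x| ≤ M * x ^ 2 := by
  obtain ⟨C, hC, δ, hδ, hb⟩ := hbound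
  obtain ⟨B, hB⟩ := (hper.isBounded_of_continuous hc hcont).exists_norm_le
  have hB' : ∀ x, |f x| ≤ B := fun x => hB _ ⟨x, rfl⟩
  have hB0 : 0 ≤ B := (abs_nonneg _).trans (hB' 0)
  have hδB : 0 ≤ B / δ ^ 2 := by positivity
  refine ⟨B + C + B / δ ^ 2, by positivity, fun x => ⟨by linarith [hB' x], ?_⟩⟩
  rcases le_or_gt |x| δ with hx | hx
  · refine (hb x hx).trans ?_
    gcongr
    linarith
  · have hsq : δ ^ 2 ≤ x ^ 2 := by
      rw [← sq_abs x]
      gcongr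
    calc |f x| ≤ B := hB' x
      _ = B / δ ^ 2 * δ ^ 2 := by field_simp
      _ ≤ (B + C + B / δ ^ 2) * x ^ 2 := by
        gcongr
        linarith

theorem summable_pow_natAbs {r : ℝ} (h₀ : 0 ≤ r) (h₁ : r < 1) :
    Summable fun l : ℤ => r ^ l.natAbs := by
  apply Summable.of_nat_of_neg <;> simpa using summable_geometric_of_lt_one h₀ h₁

/-- The terms of the self-similar series decay geometrically in both directions, uniformly for
bounded `x`. -/
theorem norm_selfSimilar_term_le {f : ℝ → ℝ} {q M R x : ℝ} (hq : 0 < q) (hM : 0 ≤ M)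
    (hf : ∀ x, |f x| ≤ M ∧ |f x| ≤ M * x ^ 2) (hx : |x| ≤ R) (l : ℤ) :
    ‖q ^ (-l) * f (q ^ l * x)‖ ≤ M * (1 + R ^ 2) * q⁻¹ ^ l.natAbs := by
  have hxR : x ^ 2 ≤ R ^ 2 := by
    rw [← sq_abs x]
    gcongr
  rw [norm_mul, Real.norm_of_nonneg (by positivity), Real.norm_eq_abs]
  obtain ⟨n, rfl | rfl⟩ := l.eq_nat_or_neg
  · calc q ^ (-(n : ℤ)) * |f (q ^ (n : ℤ) * x)| ≤ q ^ (-(n : ℤ)) * M := by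
          gcongr
          exact (hf _).1
      _ = M * 1 * q⁻¹ ^ n := by simp [mul_comm]
      _ ≤ M * (1 + R ^ 2) * q⁻¹ ^ (n : ℤ).natAbs := by
          rw [Int.natAbs_natCast]
          gcongr
          linarith [sq_nonneg R]
  · calc q ^ (-(-(n : ℤ))) * |f (q ^ (-(n : ℤ)) * x)|
        ≤ q ^ (-(-(n : ℤ))) * (M * (q ^ (-(n : ℤ)) * x) ^ 2) := by
          gcongr
          exact (hf _).2
      _ = M * x ^ 2 * q⁻¹ ^ n := by
          simp only [neg_neg, zpow_neg, zpow_natCast, inv_pow]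
          field_simp
      _ ≤ M * (1 + R ^ 2) * q⁻¹ ^ (-(n : ℤ)).natAbs := by
          rw [Int.natAbs_neg, Int.natAbs_natCast]
          gcongr
          linarith

/-- The functional equation of the self-similar series follows from shifting the index. -/
theorem tsum_selfSimilar_mul {q : ℝ} (hq : q ≠ 0) (f : ℝ → ℝ) (x : ℝ) :
    ∑' l : ℤ, q ^ (-l) * f (q ^ l * (q * x)) = q * ∑' l : ℤ, q ^ (-l) * f (q ^ l * x) := by
  rw [← tsum_mul_left, ← (Equiv.addRight (1 : ℤ)).tsum_eq fun l => q * (q ^ (-l) * f (q ^ l * x))]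
  refine tsum_congr fun l => ?_
  rw [Equiv.coe_addRight, ← mul_assoc, ← mul_assoc, ← zpow_add_one₀ hq, ← zpow_one_add₀ hq]
  congr 2
  ring

/-- Let `p ≥ 2` be an integer and `f : ℝ → ℝ` continuous with period
`1`, with `|f(x)| ≤ C x²` for `|x| ≤ δ` (some `C, δ > 0`). Then for every real `x` the
family `(p^{-ℓ} f(p^ℓ x))_{ℓ∈ℤ}` is summable, the function
`d(x) = Σ_{ℓ∈ℤ} p^{-ℓ} f(p^ℓ x)` is continuous, and `d(px) = p d(x)` for all `x`. -/
theorem selfSimilar_sum_continuous (p : ℕ) (hp : 2 ≤ p) (f : ℝ → ℝ)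
    (hcont : Continuous f) (hper : ∀ x : ℝ, f (x + 1) = f x)
    (hbound : ∃ C > (0:ℝ), ∃ δ > (0:ℝ), ∀ x : ℝ, |x| ≤ δ → |f x| ≤ C * x ^ 2) :
    (∀ x : ℝ, Summable (fun l : ℤ => (p : ℝ) ^ (-l) * f ((p : ℝ) ^ l * x)))
    ∧ Continuous (fun x : ℝ => ∑' l : ℤ, (p : ℝ) ^ (-l) * f ((p : ℝ) ^ l * x))
    ∧ ∀ x : ℝ, (∑' l : ℤ, (p : ℝ) ^ (-l) * f ((p : ℝ) ^ l * ((p : ℝ) * x))) =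
        (p : ℝ) * ∑' l : ℤ, (p : ℝ) ^ (-l) * f ((p : ℝ) ^ l * x) := by
  have hp₁ : (1 : ℝ) < p := by exact_mod_cast hp
  have hp₀ : (0 : ℝ) < p := by linarith
  obtain ⟨M, hM, hf⟩ := exists_bound_and_sq_bound_of_periodic one_ne_zero hcont hper hbound
  have hsum (R : ℝ) : Summable fun l : ℤ => M * (1 + R ^ 2) * (p : ℝ)⁻¹ ^ l.natAbs :=
    (summable_pow_natAbs (by positivity) (inv_lt_one_of_one_lt₀ hp₁)).mul_left _
  refine ⟨fun x => (hsum |x|).of_norm_bounded (norm_selfSimilar_term_le hp₀ hM hf le_rfl), ?_,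
    tsum_selfSimilar_mul hp₀.ne' f⟩
  refine continuous_iff_continuousAt.2 fun x => ?_
  have hon : ContinuousOn (fun x : ℝ => ∑' l : ℤ, (p : ℝ) ^ (-l) * f ((p : ℝ) ^ l * x))
      {y | |y| < |x| + 1} :=
    continuousOn_tsum (fun l => by fun_prop) (hsum (|x| + 1))
      fun l y hy => norm_selfSimilar_term_le hp₀ hM hf (le_of_lt hy) l
  exact hon.continuousAt ((isOpen_lt (by fun_prop) (by fun_prop)).mem_nhds (lt_add_one |x|))
end
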